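/- arXiv:2301.06423 — 3 statements merged into one kernel-verified Lean document; each statement's English description precedes it below -/
import Mathlib

section
/- Let r ≥ 2 and let G be a finite simple graph on n vertices that contains no complete subgraph K_{r+1}. Then ρ_r(G) ≤ ρ_r(T_r(n)), where T_r(n) is the r-partite Turán graph on n vertices. -/
open Finset

/-- The finset of all `r`-cliques (sets of `r` pairwise adjacent vertices) of `G`. -/
noncomputable def rCliques {V : Type*} [Fintype V] [DecidableEq V]
    (G : SimpleGraph V) (r : ℕ) : Finset (Finset V) :=
  letI := Classical.decPred (fun K : Finset V => G.IsNClique r K)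
  Finset.univ.filter (fun K => G.IsNClique r K)

/-- The `r`-clique spectral radius of `G`: the supremum over nonnegative vectors `x`
with `∑ v, x v ^ r = 1` of `r * ∑_{K an r-clique} ∏_{i ∈ K} x i`. -/
noncomputable def cliqueSpecRad {V : Type*} [Fintype V] [DecidableEq V]
    (G : SimpleGraph V) (r : ℕ) : ℝ :=
  sSup { y : ℝ | ∃ x : V → ℝ, (∀ v, 0 ≤ x v) ∧ (∑ v, x v ^ r) = 1 ∧
    y = r * ∑ K ∈ rCliques G r, ∏ i ∈ K, x i }



lemma aux_mem_rCliques {V : Type*} [Fintype V] [DecidableEq V]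
    (G : SimpleGraph V) (r : ℕ) (K : Finset V) : K ∈ rCliques G r ↔ G.IsNClique r K := by
  simp [rCliques]

lemma aux_color {V : Type*} [Fintype V] [DecidableEq V] (G : SimpleGraph V)
    (x : V → ℝ) (hx : ∀ v, 0 ≤ x v) (r : ℕ) : ∀ S : Finset V,
    (∀ K ⊆ S, ¬ G.IsNClique (r + 1) K) →
    ∃ c : V → ℕ, ∑ K ∈ (rCliques G r).filter (· ⊆ S), ∏ i ∈ K, x i ≤
      ∏ i ∈ range r, ∑ v ∈ S.filter (fun v => c v = i), x v := by
  classical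
  induction r with
  | zero =>
    intro S hS
    refine ⟨fun _ => 0, ?_⟩
    have h : (rCliques G 0).filter (· ⊆ S) ⊆ {∅} := by
      intro K hK
      rw [mem_filter, aux_mem_rCliques] at hK
      simpa using hK.1.card_eq
    calc _ ≤ ∑ K ∈ ({∅} : Finset (Finset V)), ∏ i ∈ K, x i :=
          sum_le_sum_of_subset_of_nonneg h (fun K _ _ => prod_nonneg fun i _ => hx i)
      _ ≤ _ := by simp
  | succ r ih =>
    intro S hS
    rcases S.eq_empty_or_nonempty with rfl | hne
    · refine ⟨fun _ => 0, ?_⟩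
      rw [sum_eq_zero]
      · exact prod_nonneg fun i _ => sum_nonneg fun v _ => hx v
      · intro K hK
        rw [mem_filter, aux_mem_rCliques, subset_empty] at hK
        have := hK.1.card_eq
        simp [hK.2] at this
    · let N : V → Finset V := fun u => S.filter (fun w => G.Adj u w)
      let L : V → ℝ := fun u => ∑ K ∈ (rCliques G r).filter (· ⊆ N u), ∏ i ∈ K, x i
      obtain ⟨v, hvS, hv⟩ := exists_max_image S L hne
      have hins : ∀ u ∈ S, ∀ m, ∀ K ⊆ N u, G.IsNClique m K → G.IsNClique (m + 1) (insert u K) := by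
        intro u hu m K hK hc
        exact hc.insert fun b hb => (mem_filter.1 (hK hb)).2
      obtain ⟨c, hc⟩ := ih (N v) (by
        intro K hK hcl
        refine hS (insert v K) ?_ (hins v hvS _ K hK hcl)
        exact insert_subset hvS (hK.trans (filter_subset _ _)))
      have hLnn : ∀ u, 0 ≤ L u := fun u => sum_nonneg fun K _ => prod_nonneg fun i _ => hx i
      have key : ∑ K ∈ (rCliques G (r+1)).filter (· ⊆ S), ∏ i ∈ K, x i ≤
          ∑ u ∈ S \ N v, x u * L u := by
        have h1 : ∀ u, x u * L u = ∑ K ∈ (rCliques G r).filter (· ⊆ N u), ∏ i ∈ insert u K, x i := by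
          intro u
          rw [mul_sum]
          refine sum_congr rfl fun K hK => ?_
          rw [prod_insert]
          intro hu
          have := (mem_filter.1 ((mem_filter.1 hK).2 hu)).2
          exact G.loopless.irrefl u this
        simp_rw [h1]
        rw [sum_sigma']
        let T := (S \ N v).sigma (fun u => (rCliques G r).filter (· ⊆ N u))
        let g : (Σ _ : V, Finset V) → Finset V := fun p => insert p.1 p.2
        have hsub : (rCliques G (r+1)).filter (· ⊆ S) ⊆ T.image g := by
          intro K hK
          rw [mem_filter, aux_mem_rCliques] at hK
          obtain ⟨hK, hKS⟩ := hK
          have : ¬ K ⊆ N v := by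
            intro h
            refine hS (insert v K) (insert_subset hvS hKS) (hins v hvS _ K h hK)
          obtain ⟨u, huK, hu⟩ := not_subset.1 this
          rw [mem_image]
          refine ⟨⟨u, K.erase u⟩, ?_, insert_erase huK⟩
          simp only [T, mem_sigma, mem_sdiff, mem_filter, aux_mem_rCliques]
          refine ⟨⟨hKS huK, hu⟩, ?_, ?_⟩
          · have := hK.erase_of_mem huK
            simpa using this
          · intro w hw
            rw [mem_erase] at hw
            exact mem_filter.2 ⟨hKS hw.2, hK.isClique huK hw.2 hw.1.symm⟩
        calc _ ≤ ∑ K ∈ T.image g, ∏ i ∈ K, x i :=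
              sum_le_sum_of_subset_of_nonneg hsub (fun K _ _ => prod_nonneg fun i _ => hx i)
          _ ≤ ∑ p ∈ T, ∏ i ∈ g p, x i :=
              sum_image_le_of_nonneg (fun K _ => prod_nonneg fun i _ => hx i)
      refine ⟨fun u => if u ∈ N v then c u else r, ?_⟩
      calc _ ≤ _ := key
        _ ≤ ∑ u ∈ S \ N v, x u * L v := by
            refine sum_le_sum fun u hu => mul_le_mul_of_nonneg_left (hv u (mem_sdiff.1 hu).1) (hx u)
        _ = L v * ∑ u ∈ S \ N v, x u := by rw [← sum_mul, mul_comm]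
        _ ≤ (∏ i ∈ range r, ∑ v ∈ (N v).filter (fun v => c v = i), x v) * ∑ u ∈ S \ N v, x u :=
            mul_le_mul_of_nonneg_right hc (sum_nonneg fun i _ => hx i)
        _ ≤ _ := by
            rw [prod_range_succ]
            have hsubs : ∀ A B : Finset V, A ⊆ B → ∑ u ∈ A, x u ≤ ∑ u ∈ B, x u := fun A B h =>
              sum_le_sum_of_subset_of_nonneg h fun i _ _ => hx i
            refine mul_le_mul (prod_le_prod (fun i _ => sum_nonneg fun v _ => hx v) ?_) (hsubs _ _ ?_)
              (sum_nonneg fun v _ => hx v) (prod_nonneg fun i _ => sum_nonneg fun v _ => hx v)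
            · intro i hi
              refine hsubs _ _ ?_
              intro u hu
              rw [mem_filter] at hu ⊢
              refine ⟨(mem_filter.1 hu.1).1, ?_⟩
              simp only [if_pos hu.1]; exact hu.2
            · intro u hu
              rw [mem_sdiff] at hu
              rw [mem_filter]
              exact ⟨hu.1, if_neg hu.2⟩

lemma aux_tangent (q m : ℕ) : m * (q+1)^q * q^m ≤ q^(q+1) * (q+1)^m := by
  rcases le_total q m with h | h
  · induction m, h using Nat.le_induction with
    | base => apply le_of_eq; ring
    | succ m hm ih =>
      calc (m+1) * (q+1)^q * q^(m+1) = ((m+1)*q) * ((q+1)^q * q^m) := by ring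
        _ ≤ (m * (q+1)) * ((q+1)^q * q^m) := Nat.mul_le_mul_right _ (by nlinarith)
        _ = (q+1) * (m * (q+1)^q * q^m) := by ring
        _ ≤ (q+1) * (q^(q+1) * (q+1)^m) := Nat.mul_le_mul_left _ ih
        _ = _ := by ring
  · induction h using Nat.decreasingInduction with
    | self => apply le_of_eq; ring
    | of_succ m hm ih =>
      have : (q+1) * (m * (q+1)^q * q^m) ≤ (q+1) * (q^(q+1) * (q+1)^m) := by
        calc (q+1) * (m * (q+1)^q * q^m) = (m * (q+1)) * ((q+1)^q * q^m) := by ring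
          _ ≤ ((m+1)*q) * ((q+1)^q * q^m) := Nat.mul_le_mul_right _ (by nlinarith)
          _ = (m+1) * (q+1)^q * q^(m+1) := by ring
          _ ≤ _ := ih
          _ = _ := by ring
      exact Nat.le_of_mul_le_mul_left this (by omega)

lemma aux_balanced (r n : ℕ) (hr : 0 < r) (t m : ℕ → ℕ)
    (ht : ∀ i ∈ range r, t i = n / r ∨ t i = n / r + 1) (hts : ∑ i ∈ range r, t i = n)
    (hm : ∑ i ∈ range r, m i ≤ n) : ∏ i ∈ range r, m i ≤ ∏ i ∈ range r, t i := by
  set q := n / r with hq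
  rcases Nat.eq_zero_or_pos q with h0 | hpos
  · have hn : n < r := by
      rw [hq, Nat.div_eq_zero_iff] at h0; omega
    have : ∃ i ∈ range r, m i = 0 := by
      by_contra! hcon
      have : ∑ i ∈ range r, 1 ≤ ∑ i ∈ range r, m i :=
        sum_le_sum fun i hi => Nat.one_le_iff_ne_zero.2 (hcon i hi)
      simp at this; omega
    obtain ⟨i, hi, h⟩ := this
    rw [prod_eq_zero hi h]; exact Nat.zero_le _
  · have h1 : (∏ i ∈ range r, m i) * ((q+1)^q)^r * q^(∑ i ∈ range r, m i) ≤
        (q^(q+1))^r * (q+1)^(∑ i ∈ range r, m i) := by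
      have := prod_le_prod' (s := range r) (fun i _ => aux_tangent q (m i))
      simpa [prod_mul_distrib, prod_pow_eq_pow_sum] using this
    have h2 : (∏ i ∈ range r, t i) * ((q+1)^q)^r * q^n = (q^(q+1))^r * (q+1)^n := by
      have : ∏ i ∈ range r, (t i * (q+1)^q * q^(t i)) = ∏ i ∈ range r, (q^(q+1) * (q+1)^(t i)) := by
        refine prod_congr rfl fun i hi => ?_
        rcases ht i hi with h | h <;> rw [h] <;> ring
      simpa [prod_mul_distrib, prod_pow_eq_pow_sum, hts] using this
    set M := ∑ i ∈ range r, m i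
    obtain ⟨d, hd⟩ := Nat.exists_eq_add_of_le hm
    have h3 : (∏ i ∈ range r, m i) * (((q+1)^q)^r * q^n) ≤
        (∏ i ∈ range r, t i) * (((q+1)^q)^r * q^n) := by
      calc _ = ((∏ i ∈ range r, m i) * ((q+1)^q)^r * q^M) * q^d := by rw [hd]; ring
        _ ≤ ((q^(q+1))^r * (q+1)^M) * (q+1)^d :=
          Nat.mul_le_mul h1 (Nat.pow_le_pow_left (by omega) _)
        _ = (q^(q+1))^r * (q+1)^n := by rw [hd]; ring
        _ = _ := by rw [← h2]; ring
    exact Nat.le_of_mul_le_mul_right h3 (by positivity)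

lemma aux_amgm (r : ℕ) (hr : 0 < r) (a : ℕ → ℝ) (ha : ∀ i, 0 ≤ a i)
    (hs : ∑ i ∈ range r, a i ≤ 1) : (r:ℝ)^r * ∏ i ∈ range r, a i ≤ 1 := by
  have hr' : (0:ℝ) < r := by exact_mod_cast hr
  have h := Real.geom_mean_le_arith_mean_weighted (range r) (fun _ => (r:ℝ)⁻¹) a
    (fun i _ => by positivity) (by simp [hr'.ne']) (fun i _ => ha i)
  rw [← mul_sum] at h
  have h2 : ∏ i ∈ range r, a i ^ ((r:ℝ)⁻¹) ≤ (r:ℝ)⁻¹ :=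
    h.trans (mul_le_of_le_one_right (by positivity) hs)
  have h3 := pow_le_pow_left₀ (prod_nonneg fun i _ => Real.rpow_nonneg (ha i) _) h2 r
  rw [← prod_pow, prod_congr rfl
    (fun i _ => Real.rpow_inv_natCast_pow (ha i) (by omega : r ≠ 0))] at h3
  calc (r:ℝ)^r * ∏ i ∈ range r, a i ≤ (r:ℝ)^r * ((r:ℝ)⁻¹)^r :=
        mul_le_mul_of_nonneg_left h3 (by positivity)
    _ = 1 := by rw [← mul_pow, mul_inv_cancel₀ hr'.ne', one_pow]

lemma aux_upper (r n : ℕ) (hr : 2 ≤ r) (G : SimpleGraph (Fin n))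
    (hfree : G.CliqueFree (r + 1)) (x : Fin n → ℝ) (hx : ∀ v, 0 ≤ x v)
    (hs : ∑ v, x v ^ r = 1) (t : ℕ → ℕ)
    (ht : ∀ i ∈ range r, t i = n / r ∨ t i = n / r + 1) (hts : ∑ i ∈ range r, t i = n) :
    (r * ∑ K ∈ rCliques G r, ∏ i ∈ K, x i) ^ r ≤ ((∏ i ∈ range r, t i : ℕ) : ℝ) ^ (r - 1) := by
  obtain ⟨c, hc⟩ := aux_color G x hx r univ (fun K _ => hfree K)
  have hfil : (rCliques G r).filter (· ⊆ univ) = rCliques G r := by simp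
  rw [hfil] at hc
  let C : ℕ → Finset (Fin n) := fun i => univ.filter (fun v => c v = i)
  have hdisj : ((range r : Finset ℕ) : Set ℕ).PairwiseDisjoint C := by
    intro i _ j _ hij
    refine disjoint_left.2 fun v hv hv' => hij ?_
    rw [← (mem_filter.1 hv).2, (mem_filter.1 hv').2]
  have hcard : ∑ i ∈ range r, (C i).card ≤ n := by
    rw [← card_biUnion hdisj]
    simpa using card_le_univ ((range r).biUnion C)
  have hbal := aux_balanced r n (by omega) t (fun i => (C i).card) ht hts hcard
  have hpow : ∀ i, (∑ v ∈ C i, x v) ^ r ≤ ((C i).card : ℝ)^(r-1) * ∑ v ∈ C i, x v ^ r := by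
    intro i
    obtain ⟨k, rfl⟩ : ∃ k, r = k + 1 := ⟨r - 1, by omega⟩
    have h := pow_sum_div_card_le_sum_pow (s := C i) (f := x) (fun v _ => hx v) k
    rcases (C i).eq_empty_or_nonempty with he | hne
    · rw [he]; simp
    · have hpos : (0:ℝ) < ((C i).card : ℝ) ^ k := by
        have := hne.card_pos
        positivity
      rw [div_le_iff₀ hpos] at h
      rw [Nat.add_sub_cancel, mul_comm]
      exact h
  have hsum : ∑ i ∈ range r, ∑ v ∈ C i, x v ^ r ≤ 1 := by
    rw [← sum_biUnion hdisj, ← hs]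
    exact sum_le_sum_of_subset_of_nonneg (subset_univ _) fun v _ _ => pow_nonneg (hx v) _
  have hann : ∀ i, 0 ≤ ∑ v ∈ C i, x v ^ r := fun i => sum_nonneg fun v _ => pow_nonneg (hx v) _
  have hag := aux_amgm r (by omega) (fun i => ∑ v ∈ C i, x v ^ r) hann hsum
  have hLn : 0 ≤ ∑ K ∈ rCliques G r, ∏ i ∈ K, x i :=
    sum_nonneg fun K _ => prod_nonneg fun i _ => hx i
  calc (r * ∑ K ∈ rCliques G r, ∏ i ∈ K, x i) ^ r
      ≤ (r * ∏ i ∈ range r, ∑ v ∈ C i, x v) ^ r := by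
        refine pow_le_pow_left₀ (by positivity) (mul_le_mul_of_nonneg_left hc (by positivity)) _
    _ = (r:ℝ)^r * ∏ i ∈ range r, (∑ v ∈ C i, x v)^r := by rw [mul_pow, prod_pow]
    _ ≤ (r:ℝ)^r * ∏ i ∈ range r, (((C i).card : ℝ)^(r-1) * ∑ v ∈ C i, x v ^ r) := by
        refine mul_le_mul_of_nonneg_left (prod_le_prod (fun i _ => ?_) (fun i _ => hpow i))
          (by positivity)
        exact pow_nonneg (sum_nonneg fun v _ => hx v) _
    _ = ((∏ i ∈ range r, (C i).card : ℕ) : ℝ)^(r-1) *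
          ((r:ℝ)^r * ∏ i ∈ range r, ∑ v ∈ C i, x v ^ r) := by
        rw [prod_mul_distrib, prod_pow]; push_cast; ring
    _ ≤ ((∏ i ∈ range r, (C i).card : ℕ) : ℝ)^(r-1) * 1 :=
        mul_le_mul_of_nonneg_left hag (by positivity)
    _ ≤ _ := by
        rw [mul_one]
        exact pow_le_pow_left₀ (by positivity) (by exact_mod_cast hbal) _

/-- Size of residue class. -/
def auxT (r n i : ℕ) : ℕ := ((univ : Finset (Fin n)).filter (fun v : Fin n => (v:ℕ) % r = i)).card

lemma auxT_eq (r n : ℕ) (hr : 0 < r) : ∀ i ∈ range r, auxT r n i = n / r ∨ auxT r n i = n / r + 1 := by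
  intro i hi
  have h := Nat.count_modEq_card n hr i
  have : auxT r n i = n.count (· ≡ i [MOD r]) := by
    rw [Nat.count_eq_card_filter_range, auxT]
    refine card_bij (fun v _ => (v:ℕ)) ?_ ?_ ?_
    · intro v hv
      simp only [mem_filter, mem_univ, true_and, mem_range] at hv ⊢
      refine ⟨v.2, ?_⟩
      rw [Nat.ModEq, hv, Nat.mod_eq_of_lt (mem_range.1 hi)]
    · intro a _ b _ h; exact Fin.ext h
    · intro b hb
      simp only [mem_filter, mem_range] at hb
      refine ⟨⟨b, hb.1⟩, ?_, rfl⟩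
      have := hb.2
      rw [Nat.ModEq, Nat.mod_eq_of_lt (mem_range.1 hi)] at this
      simpa using this
  rw [this, h]
  split_ifs <;> simp

lemma auxT_sum (r n : ℕ) (hr : 0 < r) : ∑ i ∈ range r, auxT r n i = n := by
  have := card_eq_sum_card_fiberwise (s := (univ : Finset (Fin n))) (t := range r)
    (f := fun v : Fin n => (v:ℕ) % r) (fun v _ => by simpa using Nat.mod_lt _ hr)
  simpa [auxT] using this.symm

lemma aux_lower (r n : ℕ) (x : Fin n → ℝ) (hx : ∀ v, 0 ≤ x v) :
    ∏ i ∈ range r, ∑ v ∈ univ.filter (fun v : Fin n => (v:ℕ) % r = i), x v ≤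
      ∑ K ∈ rCliques (SimpleGraph.turanGraph n r) r, ∏ i ∈ K, x i := by
  classical
  rw [prod_range, prod_univ_sum]
  set P := Fintype.piFinset fun i : Fin r => univ.filter (fun v : Fin n => (v:ℕ) % r = i) with hP
  have hmem : ∀ p ∈ P, ∀ i, (p i : ℕ) % r = i := by
    intro p hp i
    have := Fintype.mem_piFinset.1 hp i
    exact (mem_filter.1 this).2
  have hinj : ∀ p ∈ P, Function.Injective p := by
    intro p hp i j hij
    apply Fin.ext
    rw [← hmem p hp i, ← hmem p hp j, hij]
  have h1 : ∑ p ∈ P, ∏ i, x (p i) = ∑ p ∈ P, ∏ v ∈ univ.image p, x v := by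
    refine sum_congr rfl fun p hp => ?_
    rw [prod_image (fun a _ b _ h => hinj p hp h)]
  rw [h1]
  have hinj2 : Set.InjOn (fun p : Fin r → Fin n => univ.image p) P := by
    intro p hp p' hp' h
    funext i
    have h2 : p i ∈ univ.image p' := by
      have h : univ.image p = univ.image p' := h
      rw [← h]; exact mem_image_of_mem _ (mem_univ _)
    obtain ⟨j, _, hj⟩ := mem_image.1 h2
    have : j = i := by
      apply Fin.ext
      rw [← hmem p hp i, ← hmem p' hp' j, hj]
    rw [← hj, this]
  rw [← sum_image (f := fun K => ∏ v ∈ K, x v) hinj2]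
  refine sum_le_sum_of_subset_of_nonneg ?_ fun K _ _ => prod_nonneg fun i _ => hx i
  intro K hK
  obtain ⟨p, hp, rfl⟩ := mem_image.1 hK
  rw [aux_mem_rCliques, SimpleGraph.isNClique_iff]
  constructor
  · intro a ha b hb hab
    simp only [coe_image, coe_univ, Set.image_univ, Set.mem_range] at ha hb
    obtain ⟨i, rfl⟩ := ha
    obtain ⟨j, rfl⟩ := hb
    change (p i : ℕ) % r ≠ (p j : ℕ) % r
    rw [hmem p hp, hmem p hp]
    intro h
    exact hab (by rw [Fin.ext h])
  · rw [card_image_of_injective _ (hinj p hp)]; simp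

theorem stmt_2 (r n : ℕ) (hr : 2 ≤ r) (G : SimpleGraph (Fin n))
    (hfree : G.CliqueFree (r + 1)) :
    cliqueSpecRad G r ≤ cliqueSpecRad (SimpleGraph.turanGraph n r) r := by
  have hr0 : 0 < r := by omega
  have hrR : (0:ℝ) < r := by exact_mod_cast hr0
  have hT := auxT_eq r n hr0
  have hTs := auxT_sum r n hr0
  by_cases hz : ∃ i ∈ range r, auxT r n i = 0
  · obtain ⟨i, hi, h0⟩ := hz
    refine le_trans (b := (0:ℝ)) (Real.sSup_le ?_ le_rfl) (Real.sSup_nonneg ?_)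
    · rintro y ⟨x, hx, hs, rfl⟩
      have := aux_upper r n hr G hfree x hx hs _ hT hTs
      rw [prod_eq_zero hi h0, Nat.cast_zero, zero_pow (by omega)] at this
      by_contra! hcon
      exact absurd this (not_le.2 (pow_pos hcon _))
    · rintro y ⟨x, hx, hs, rfl⟩
      exact mul_nonneg hrR.le (sum_nonneg fun K _ => prod_nonneg fun i _ => hx i)
  · push Not at hz
    have htpos : ∀ i ∈ range r, (0:ℝ) < auxT r n i := fun i hi => by
      exact_mod_cast Nat.pos_of_ne_zero (hz i hi)
    let w : ℕ → ℝ := fun i => (1 / (r * auxT r n i : ℝ)) ^ ((r:ℝ)⁻¹)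
    have hw0 : ∀ i, 0 ≤ w i := fun i => by positivity
    have hw : ∀ i, w i ^ r = 1 / (r * auxT r n i : ℝ) := fun i =>
      Real.rpow_inv_natCast_pow (by positivity) (by omega)
    let x : Fin n → ℝ := fun v => w ((v:ℕ) % r)
    have hfib : ∀ f : ℕ → ℝ, ∀ i, ∑ v ∈ univ.filter (fun v : Fin n => (v:ℕ) % r = i), f ((v:ℕ) % r)
        = auxT r n i * f i := by
      intro f i
      rw [sum_congr rfl (g := fun _ => f i) (fun v hv => by rw [(mem_filter.1 hv).2])]
      simp [auxT]
    have hxs : ∑ v, x v ^ r = 1 := by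
      rw [← sum_fiberwise_of_maps_to (t := range r) (g := fun v : Fin n => (v:ℕ) % r)
        (fun v _ => by simpa using Nat.mod_lt _ hr0)]
      rw [sum_congr rfl (g := fun _ => (1:ℝ) / r)]
      · simp; field_simp
      · intro i hi
        rw [hfib (fun j => w j ^ r) i, hw]
        have := htpos i hi
        field_simp
    have hlow := aux_lower r n x (fun v => hw0 _)
    let y0 : ℝ := r * ∏ i ∈ range r, (auxT r n i * w i)
    have hy00 : 0 ≤ y0 := mul_nonneg hrR.le (prod_nonneg fun i _ => mul_nonneg (by positivity) (hw0 i))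
    have hy0 : y0 ^ r = ((∏ i ∈ range r, auxT r n i : ℕ) : ℝ) ^ (r - 1) := by
      simp only [y0]
      rw [mul_pow, ← prod_pow]
      have : ∀ i ∈ range r, ((auxT r n i : ℝ) * w i)^r = (1/(r:ℝ)) * (auxT r n i : ℝ)^(r-1) := by
        intro i hi
        have := htpos i hi
        rw [mul_pow, hw]
        obtain ⟨k, rfl⟩ : ∃ k, r = k + 1 := ⟨r - 1, by omega⟩
        rw [Nat.add_sub_cancel, pow_succ]
        field_simp
      rw [prod_congr rfl this, prod_mul_distrib, prod_pow, prod_const, card_range, ← mul_assoc,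
        ← mul_pow, mul_one_div_cancel hrR.ne', one_pow, one_mul]
      push_cast; rfl
    have hbd : ∀ H : SimpleGraph (Fin n), H.CliqueFree (r+1) → ∀ y ∈ { y : ℝ | ∃ x : Fin n → ℝ,
        (∀ v, 0 ≤ x v) ∧ (∑ v, x v ^ r) = 1 ∧ y = r * ∑ K ∈ rCliques H r, ∏ i ∈ K, x i }, y ≤ y0 := by
      rintro H hH y ⟨x, hx, hs, rfl⟩
      have := aux_upper r n hr H hH x hx hs _ hT hTs
      rw [← hy0] at this
      exact le_of_pow_le_pow_left₀ (by omega) hy00 this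
    have hlow' : y0 ≤ r * ∑ K ∈ rCliques (SimpleGraph.turanGraph n r) r, ∏ i ∈ K, x i := by
      refine mul_le_mul_of_nonneg_left (le_trans (le_of_eq ?_) hlow) hrR.le
      exact prod_congr rfl fun i _ => (hfib w i).symm
    have hge : y0 ≤ cliqueSpecRad (SimpleGraph.turanGraph n r) r :=
      hlow'.trans (le_csSup ⟨y0, fun y hy => hbd _ (SimpleGraph.turanGraph_cliqueFree hr0) y hy⟩
        ⟨x, fun v => hw0 _, hxs, rfl⟩)
    exact (Real.sSup_le (hbd G hfree) hy00).trans hge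
end

section
/- Let r ≥ 2 and n ≥ r. The r-clique spectral radius of the r-partite Turán graph satisfies ρ_r(T_r(n)) = (∏_{s=0}^{r-1} ⌊(n+s)/r⌋)^{(r-1)/r}. -/
open Finset

noncomputable def ptn (n r : ℕ) (j : Fin r) : Finset (Fin n) :=
  Finset.univ.filter (fun v => (v : ℕ) % r = j)

lemma mem_ptn {n r : ℕ} {j : Fin r} {v : Fin n} : v ∈ ptn n r j ↔ (v : ℕ) % r = j := by
  simp [ptn]

lemma ptn_card (n r : ℕ) (j : Fin r) : (ptn n r j).card = (n + (r - 1 - j)) / r := by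
  have hj := j.2
  have hr : 0 < r := by omega
  have h1 : (ptn n r j).card = Nat.count (· ≡ (j : ℕ) [MOD r]) n := by
    rw [Nat.count_eq_card_filter_range, ← Finset.card_map (Fin.valEmbedding)]
    congr 1
    ext v
    simp only [ptn, Finset.mem_map, Finset.mem_filter, Finset.mem_univ, true_and, Finset.mem_range,
      Fin.valEmbedding_apply, Nat.ModEq, Nat.mod_eq_of_lt hj]
    constructor
    · rintro ⟨a, ha, rfl⟩
      exact ⟨a.2, ha⟩
    · rintro ⟨h1, h2⟩
      exact ⟨⟨v, h1⟩, h2, rfl⟩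
  rw [h1, Nat.count_modEq_card _ hr, Nat.mod_eq_of_lt hj]
  have h2 := Nat.div_add_mod n r
  have h3 := Nat.mod_lt n hr
  generalize hq : n / r = q at *
  generalize hm : n % r = m at *
  symm
  split_ifs with h
  · rw [Nat.div_eq_iff hr]
    have : (q + 1) * r = r * q + r := by ring
    omega
  · rw [Nat.div_eq_iff hr]
    have : (q + 0) * r = r * q := by ring
    omega

lemma prod_card (n r : ℕ) : ∏ j : Fin r, (ptn n r j).card = ∏ s ∈ Finset.range r, ((n + s) / r) := by
  simp_rw [ptn_card]
  rw [Fin.prod_univ_eq_prod_range (fun j => (n + (r - 1 - j)) / r) r]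
  exact Finset.prod_range_reflect (fun s => (n + s) / r) r

lemma sum_cl (n r : ℕ) (x : Fin n → ℝ) :
    ∑ K ∈ rCliques (SimpleGraph.turanGraph n r) r, ∏ i ∈ K, x i
      = ∏ j : Fin r, ∑ v ∈ ptn n r j, x v := by
  classical
  rw [Finset.prod_univ_sum]
  symm
  have inj : ∀ f ∈ Fintype.piFinset (ptn n r), Function.Injective f := by
    intro f hf a b hab
    rw [Fintype.mem_piFinset] at hf
    have ha := mem_ptn.1 (hf a)
    have hb := mem_ptn.1 (hf b)
    apply Fin.ext
    rw [← ha, ← hb, hab]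
  refine Finset.sum_bij (fun f _ => Finset.univ.image f) ?_ ?_ ?_ ?_
  · intro f hf
    have hi := inj f hf
    rw [Fintype.mem_piFinset] at hf
    simp only [rCliques, Finset.mem_filter, Finset.mem_univ, true_and]
    rw [SimpleGraph.isNClique_iff, Finset.card_image_of_injective _ hi]
    refine ⟨?_, by simp⟩
    intro a ha b hb hab
    simp only [Finset.coe_image, Finset.coe_univ, Set.image_univ, Set.mem_range] at ha hb
    obtain ⟨i, rfl⟩ := ha
    obtain ⟨k, rfl⟩ := hb
    rw [SimpleGraph.turanGraph_adj, mem_ptn.1 (hf i), mem_ptn.1 (hf k)]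
    intro h
    exact hab (congrArg f (Fin.ext h))
  · intro f hf g hg h
    rw [Fintype.mem_piFinset] at hf hg
    funext i
    have : f i ∈ Finset.univ.image g := by
      rw [← h]; simp
    obtain ⟨k, -, hk⟩ := Finset.mem_image.1 this
    have : k = i := by
      apply Fin.ext
      rw [← mem_ptn.1 (hf i), ← mem_ptn.1 (hg k), hk]
    rw [← hk, this]
  · intro K hK
    simp only [rCliques, Finset.mem_filter, Finset.mem_univ, true_and] at hK
    rw [SimpleGraph.isNClique_iff] at hK
    obtain ⟨hc, hcard⟩ := hK
    have hinj : Set.InjOn (fun v : Fin n => (v : ℕ) % r) K := by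
      intro a ha b hb hab
      by_contra hne
      exact (SimpleGraph.turanGraph_adj.1 (hc ha hb hne)) hab
    have him : K.image (fun v : Fin n => (v : ℕ) % r) = Finset.range r := by
      apply Finset.eq_of_subset_of_card_le
      · intro y hy
        obtain ⟨v, hv, rfl⟩ := Finset.mem_image.1 hy
        have : 0 < r := by rw [← hcard]; exact Finset.card_pos.2 ⟨v, hv⟩
        exact Finset.mem_range.2 (Nat.mod_lt _ this)
      · rw [Finset.card_image_of_injOn hinj, hcard, Finset.card_range]
    have hex : ∀ j : Fin r, ∃ v ∈ K, (v : ℕ) % r = j := by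
      intro j
      have : (j : ℕ) ∈ K.image (fun v : Fin n => (v : ℕ) % r) := by rw [him]; simp
      simpa using this
    choose f hfK hf using hex
    have hfm : f ∈ Fintype.piFinset (ptn n r) := by
      rw [Fintype.mem_piFinset]; intro i; exact mem_ptn.2 (hf i)
    refine ⟨f, hfm, ?_⟩
    apply Finset.eq_of_subset_of_card_le
    · intro y hy
      obtain ⟨v, hv, rfl⟩ := Finset.mem_image.1 hy
      exact hfK v
    · rw [Finset.card_image_of_injective _ (inj f hfm), hcard]; simp
  · intro f hf
    rw [Finset.prod_image (fun a _ b _ h => inj f hf h)]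

lemma sum_ptn (n r : ℕ) (hr : 0 < r) (g : Fin n → ℝ) :
    ∑ j : Fin r, ∑ v ∈ ptn n r j, g v = ∑ v, g v := by
  have := Finset.sum_fiberwise (Finset.univ : Finset (Fin n))
    (fun v => (⟨(v : ℕ) % r, Nat.mod_lt _ hr⟩ : Fin r)) g
  rw [← this]
  refine Finset.sum_congr rfl fun j _ => Finset.sum_congr ?_ fun _ _ => rfl
  ext v
  simp [ptn, Fin.ext_iff]

lemma amgm (r : ℕ) (hr : 0 < r) (a : Fin r → ℝ) (ha : ∀ i, 0 ≤ a i) (hs : ∑ i, a i = 1) :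
    (r : ℝ) ^ r * ∏ i, a i ≤ 1 := by
  have hr' : (0 : ℝ) < r := by exact_mod_cast hr
  have h := Real.geom_mean_le_arith_mean Finset.univ (fun _ => (1 : ℝ)) a (by simp) (by simpa using hr)
    (fun i _ => ha i)
  simp only [Real.rpow_one, Finset.sum_const, Finset.card_univ, Fintype.card_fin, nsmul_eq_mul,
    mul_one, one_mul, hs] at h
  have hp : 0 ≤ ∏ i, a i := Finset.prod_nonneg fun i _ => ha i
  have h2 := pow_le_pow_left₀ (Real.rpow_nonneg hp _) h r
  rw [Real.rpow_inv_natCast_pow hp hr.ne', div_pow, one_pow, le_div_iff₀ (by positivity)] at h2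
  linarith

theorem stmt_6 (r n : ℕ) (hr : 2 ≤ r) (hn : r ≤ n) :
    cliqueSpecRad (SimpleGraph.turanGraph n r) r
      = ((∏ s ∈ Finset.range r, ((n + s) / r) : ℕ) : ℝ) ^ (((r : ℝ) - 1) / r) := by
  have hr0 : 0 < r := by omega
  have hr' : (0 : ℝ) < r := by exact_mod_cast hr0
  obtain ⟨m, rfl⟩ : ∃ m, r = m + 1 := ⟨r - 1, by omega⟩
  set r := m + 1 with hrm
  rw [← prod_card]
  set N : Fin r → ℝ := fun j => ((ptn n r j).card : ℝ) with hN
  have hNpos : ∀ j, 0 < N j := by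
    intro j
    have : 0 < (ptn n r j).card := by
      rw [ptn_card]; exact Nat.div_pos (by omega) hr0
    exact Nat.cast_pos.2 this
  have hP : ((∏ j : Fin r, (ptn n r j).card : ℕ) : ℝ) = ∏ j, N j := by push_cast; rfl
  rw [hP]
  have hP0 : 0 ≤ ∏ j, N j := Finset.prod_nonneg fun j _ => (hNpos j).le
  set R := (∏ j, N j) ^ (((r : ℝ) - 1) / r) with hR
  have hR0 : 0 ≤ R := Real.rpow_nonneg hP0 _
  have hRr : R ^ r = ∏ j, N j ^ m := by
    rw [hR, ← Real.rpow_natCast, ← Real.rpow_mul hP0, div_mul_cancel₀ _ hr'.ne', Finset.prod_pow,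
      ← Real.rpow_natCast]
    congr 1
    rw [hrm]; push_cast; ring
  unfold cliqueSpecRad
  simp_rw [sum_cl]
  apply IsGreatest.csSup_eq
  constructor
  · have hb : ∀ j, 0 ≤ 1 / ((r : ℝ) * N j) := fun j => by have := hNpos j; positivity
    let c : Fin r → ℝ := fun j => (1 / ((r : ℝ) * N j)) ^ ((r : ℝ)⁻¹)
    have hc0 : ∀ j, 0 ≤ c j := fun j => Real.rpow_nonneg (hb j) _
    have hc : ∀ j, c j ^ r = 1 / (r * N j) := fun j => Real.rpow_inv_natCast_pow (hb j) hr0.ne'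
    let x : Fin n → ℝ := fun v => c ⟨(v : ℕ) % r, Nat.mod_lt _ hr0⟩
    have hx : ∀ j, ∀ v ∈ ptn n r j, x v = c j := by
      intro j v hv
      have := mem_ptn.1 hv
      simp only [x, this]
    refine ⟨x, fun v => hc0 _, ?_, ?_⟩
    · rw [← sum_ptn n r hr0]
      have : ∀ j, ∑ v ∈ ptn n r j, x v ^ r = 1 / r := by
        intro j
        rw [Finset.sum_congr rfl (fun v hv => by rw [hx j v hv, hc j]), Finset.sum_const,
          nsmul_eq_mul]
        have h1 : ((ptn n r j).card : ℝ) = N j := rfl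
        rw [h1]
        have := (hNpos j).ne'
        field_simp
      simp only [this, Finset.sum_const, Finset.card_univ, Fintype.card_fin, nsmul_eq_mul]
      field_simp
    · have hS : ∀ j, ∑ v ∈ ptn n r j, x v = N j * c j := by
        intro j
        rw [Finset.sum_congr rfl (hx j), Finset.sum_const, nsmul_eq_mul]
      simp only [hS]
      have h0 : 0 ≤ (r : ℝ) * ∏ j, N j * c j :=
        mul_nonneg hr'.le (Finset.prod_nonneg fun j _ => mul_nonneg (hNpos j).le (hc0 j))
      refine (pow_left_inj₀ hR0 h0 hr0.ne').1 ?_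
      rw [hRr, mul_pow, ← Finset.prod_pow]
      have h3 : ∀ j, (N j * c j) ^ r = N j ^ m * (1 / r) := by
        intro j
        rw [mul_pow, hc, hrm, pow_succ]
        have := (hNpos j).ne'
        field_simp
      simp only [h3, Finset.prod_mul_distrib, Finset.prod_const, Finset.card_univ, Fintype.card_fin]
      rw [one_div, inv_pow]
      field_simp
  · rintro y ⟨x, hx0, hx1, rfl⟩
    have hS0 : ∀ j, 0 ≤ ∑ v ∈ ptn n r j, x v := fun j => Finset.sum_nonneg fun v _ => hx0 v
    have ha0 : ∀ j, 0 ≤ ∑ v ∈ ptn n r j, x v ^ r :=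
      fun j => Finset.sum_nonneg fun v _ => pow_nonneg (hx0 v) _
    refine (pow_le_pow_iff_left₀ (mul_nonneg hr'.le (Finset.prod_nonneg fun j _ => hS0 j)) hR0 hr0.ne').1 ?_
    rw [hRr, mul_pow, ← Finset.prod_pow]
    have hj : ∀ j, (∑ v ∈ ptn n r j, x v) ^ r ≤ N j ^ m * ∑ v ∈ ptn n r j, x v ^ r := by
      intro j
      exact pow_sum_le_card_mul_sum_pow (fun v _ => hx0 v) m
    have ham := amgm r hr0 (fun j => ∑ v ∈ ptn n r j, x v ^ r) ha0
      (by rw [sum_ptn n r hr0, hx1])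
    calc (r : ℝ) ^ r * ∏ j, (∑ v ∈ ptn n r j, x v) ^ r
        ≤ (r : ℝ) ^ r * ∏ j, (N j ^ m * ∑ v ∈ ptn n r j, x v ^ r) := by
          refine mul_le_mul_of_nonneg_left (Finset.prod_le_prod (fun j _ => pow_nonneg (hS0 j) _) fun j _ => hj j) (by positivity)
      _ = (∏ j, N j ^ m) * ((r : ℝ) ^ r * ∏ j, ∑ v ∈ ptn n r j, x v ^ r) := by
          rw [Finset.prod_mul_distrib]; ring
      _ ≤ (∏ j, N j ^ m) * 1 :=
          mul_le_mul_of_nonneg_left ham (Finset.prod_nonneg fun j _ => pow_nonneg (hNpos j).le _)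
      _ = _ := mul_one _
end

section
/- Let r ≥ 2 and n ≥ r, and let G' be a graph on n vertices that is K_{r+1}-free and has the largest r-clique spectral radius among all K_{r+1}-free graphs on n vertices (i.e., ρ_r(G') ≥ ρ_r(H) for every K_{r+1}-free graph H on n vertices). Then G' is a complete r-partite graph: its vertex set can be partitioned into r nonempty parts such that two vertices are adjacent if and only if they lie in different parts. -/
open Finset

section aux
variable {V : Type*} [Fintype V] [DecidableEq V]

lemma mem_rCl {G : SimpleGraph V} {r : ℕ} {K : Finset V} :
    K ∈ rCliques G r ↔ G.IsNClique r K := by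
  simp [rCliques]

noncomputable def cF (G : SimpleGraph V) (r : ℕ) (x : V → ℝ) : ℝ :=
  ∑ K ∈ rCliques G r, ∏ i ∈ K, x i
noncomputable def cA (G : SimpleGraph V) (r : ℕ) (x : V → ℝ) (t : V) : ℝ :=
  ∑ K ∈ rCliques G r with t ∈ K, ∏ i ∈ K, x i
noncomputable def cB (G : SimpleGraph V) (r : ℕ) (x : V → ℝ) (t : V) : ℝ :=
  ∑ K ∈ rCliques G r with t ∉ K, ∏ i ∈ K, x i
noncomputable def cC (G : SimpleGraph V) (r : ℕ) (x : V → ℝ) (s t : V) : ℝ :=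
  ∑ K ∈ rCliques G r with (t ∉ K ∧ s ∈ K), ∏ i ∈ K, x i
noncomputable def cD (G : SimpleGraph V) (r : ℕ) (x : V → ℝ) (s t : V) : ℝ :=
  ∑ K ∈ rCliques G r with (t ∉ K ∧ s ∉ K), ∏ i ∈ K, x i

lemma cF_eq (G : SimpleGraph V) (r : ℕ) (x : V → ℝ) (t : V) :
    cF G r x = cA G r x t + cB G r x t :=
  (Finset.sum_filter_add_sum_filter_not _ _ _).symm

lemma cB_eq (G : SimpleGraph V) (r : ℕ) (x : V → ℝ) (s t : V) :
    cB G r x t = cC G r x s t + cD G r x s t := by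
  unfold cB cC cD
  rw [← Finset.sum_filter_add_sum_filter_not _ (fun K => s ∈ K), Finset.filter_filter,
    Finset.filter_filter]

lemma cA_eq_cC (G : SimpleGraph V) (r : ℕ) (x : V → ℝ) (s t : V) (hst : s ≠ t)
    (h : ¬ G.Adj s t) : cA G r x s = cC G r x s t := by
  unfold cA cC
  congr 1
  ext K
  simp only [Finset.mem_filter, mem_rCl]
  refine and_congr_right fun hK => ⟨fun hs => ⟨fun ht => h (hK.1 hs ht hst), hs⟩, fun h => h.2⟩

lemma repl_iff (G : SimpleGraph V) (r : ℕ) (s t : V) (K : Finset V) (ht : t ∉ K) :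
    (G.replaceVertex s t).IsNClique r K ↔ G.IsNClique r K := by
  simp only [SimpleGraph.isNClique_iff]
  refine and_congr_left fun _ => ?_
  have hne : ∀ a ∈ K, a ≠ t := fun a ha h => ht (h ▸ ha)
  constructor
  · intro h a ha b hb hab
    exact (G.adj_replaceVertex_iff_of_ne s (hne a ha) (hne b hb)).1 (h ha hb hab)
  · intro h a ha b hb hab
    exact (G.adj_replaceVertex_iff_of_ne s (hne a ha) (hne b hb)).2 (h ha hb hab)

lemma cB_repl (G : SimpleGraph V) (r : ℕ) (x : V → ℝ) (s t : V) :
    cB (G.replaceVertex s t) r x t = cB G r x t := by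
  unfold cB
  congr 1
  ext K
  simp only [Finset.mem_filter, mem_rCl]
  exact and_congr_left fun h => repl_iff G r s t K h

lemma cC_repl (G : SimpleGraph V) (r : ℕ) (x : V → ℝ) (s t a : V) :
    cC (G.replaceVertex s t) r x a t = cC G r x a t := by
  unfold cC
  congr 1
  ext K
  simp only [Finset.mem_filter, mem_rCl]
  exact and_congr_left fun h => repl_iff G r s t K h.1

lemma cA_repl (G : SimpleGraph V) (r : ℕ) (x : V → ℝ) (s t : V) (hst : s ≠ t) :
    x s * cA (G.replaceVertex s t) r x t = x t * cC G r x s t := by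
  unfold cA cC
  rw [Finset.mul_sum, Finset.mul_sum]
  have hns : ∀ K, (G.replaceVertex s t).IsNClique r K → t ∈ K → s ∉ K := by
    intro K hK ht hs
    exact G.not_adj_replaceVertex_same s t (hK.1 hs ht hst)
  refine Finset.sum_bij' (fun K _ => insert s (K.erase t)) (fun K _ => insert t (K.erase s))
    ?_ ?_ ?_ ?_ ?_
  · intro K hK
    simp only [Finset.mem_filter, mem_rCl] at hK ⊢
    obtain ⟨hK, ht⟩ := hK
    have hs := hns K hK ht
    refine ⟨?_, by simp [hst.symm], by simp⟩
    rw [← repl_iff G r s t _ (by simp [hst.symm])]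
    refine hK.insert_erase ?_ ht
    intro w hw
    simp only [Finset.mem_sdiff, Finset.mem_singleton] at hw
    rw [G.adj_replaceVertex_iff_of_ne_left s hw.2, ← G.adj_replaceVertex_iff_of_ne_right s hw.2]
    exact hK.1 ht hw.1 (Ne.symm hw.2)
  · intro K hK
    simp only [Finset.mem_filter, mem_rCl] at hK ⊢
    obtain ⟨hK, ht, hs⟩ := hK
    refine ⟨?_, by simp⟩
    refine ((repl_iff G r s t _ ht).2 hK).insert_erase ?_ hs
    intro w hw
    simp only [Finset.mem_sdiff, Finset.mem_singleton] at hw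
    have hwt : w ≠ t := fun h => ht (h ▸ hw.1)
    rw [G.adj_replaceVertex_iff_of_ne_right s hwt]
    exact hK.1 hs hw.1 (Ne.symm hw.2)
  · intro K hK
    simp only [Finset.mem_filter, mem_rCl] at hK
    have hs := hns K hK.1 hK.2
    rw [Finset.erase_insert (by simp [hs]), Finset.insert_erase hK.2]
  · intro K hK
    simp only [Finset.mem_filter, mem_rCl] at hK
    rw [Finset.erase_insert (by simp [hK.2.1]), Finset.insert_erase hK.2.2]
  · intro K hK
    simp only [Finset.mem_filter, mem_rCl] at hK
    have hs := hns K hK.1 hK.2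
    rw [Finset.prod_insert (by simp [hs]), ← Finset.mul_prod_erase K x hK.2]
    ring

def Feas (r : ℕ) (x : V → ℝ) : Prop := (∀ v, 0 ≤ x v) ∧ ∑ v, x v ^ r = 1

def CExt (r : ℕ) (x : V → ℝ) (G : SimpleGraph V) : Prop :=
  G.CliqueFree (r + 1) ∧ ∀ H : SimpleGraph V, H.CliqueFree (r + 1) →
    ∀ y, Feas r y → cF H r y ≤ cF G r x

lemma ext_pos {r : ℕ} (hr : 2 ≤ r) {x : V → ℝ} {G : SimpleGraph V} (hx : Feas r x)
    (hE : CExt r x G) (hf : 0 < cF G r x) (t : V) : 0 < x t := by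
  refine lt_of_le_of_ne (hx.1 t) fun h0 => ?_
  have hr0 : r ≠ 0 := by omega
  have hA : cA G r x t = 0 := by
    unfold cA
    refine Finset.sum_eq_zero fun K hK => ?_
    exact Finset.prod_eq_zero (Finset.mem_filter.1 hK).2 h0.symm
  obtain ⟨K, hK, hKpos⟩ : ∃ K ∈ rCliques G r, 0 < ∏ i ∈ K, x i := by
    by_contra! hcon
    exact absurd hf (not_lt.2 (Finset.sum_nonpos hcon))
  have hKc := mem_rCl.1 hK
  obtain ⟨s, hs⟩ : K.Nonempty := by
    rw [← Finset.card_pos, hKc.2]; omega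
  have hposK : ∀ i ∈ K, 0 < x i := fun i hi =>
    lt_of_le_of_ne (hx.1 i) fun h => hKpos.ne' (Finset.prod_eq_zero hi h.symm)
  have htK : t ∉ K := fun h => (hposK t h).ne h0
  have hst : s ≠ t := fun h => htK (h ▸ hs)
  have hC : 0 < cC G r x s t := by
    unfold cC
    refine Finset.sum_pos' (fun L _ => Finset.prod_nonneg fun i _ => hx.1 i) ⟨K, ?_, hKpos⟩
    simp [hK, htK, hs]
  -- the new vector
  obtain ⟨c, hc0, hc⟩ : ∃ c : ℝ, 0 < c ∧ c ^ r = 1 / 2 := by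
    refine ⟨(1/2 : ℝ) ^ (1 / (r:ℝ)), by positivity, ?_⟩
    rw [one_div (r:ℝ)]
    exact Real.rpow_inv_natCast_pow (by norm_num) hr0
  have hc2 : 1 < 2 * c := by
    by_contra! hle
    have h1 : c ≤ 1 / 2 := by linarith
    have h2 : c ^ r ≤ c ^ 2 := pow_le_pow_of_le_one hc0.le (by linarith) hr
    nlinarith
  let y : V → ℝ := fun v => if v = s ∨ v = t then c * x s else x v
  have hys : y s = c * x s := by simp [y]
  have hyt : y t = c * x s := by simp [y]
  have hyo : ∀ v, v ≠ s → v ≠ t → y v = x v := fun v h1 h2 => by simp [y, h1, h2]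
  have hy : Feas r y := by
    constructor
    · intro v
      by_cases h : v = s ∨ v = t
      · simp only [y, h, if_true]; exact mul_nonneg hc0.le (hx.1 s)
      · simp only [y, h, if_false]; exact hx.1 v
    · have key : ∀ z : V → ℝ, ∑ v, z v ^ r
          = z s ^ r + (z t ^ r + ∑ v ∈ (univ.erase s).erase t, z v ^ r) := by
        intro z
        rw [Finset.add_sum_erase _ (fun v => z v ^ r) (by simp [hst.symm]),
          Finset.add_sum_erase _ (fun v => z v ^ r) (by simp)]
      rw [← hx.2, key y, key x, hys, hyt, ← h0, zero_pow hr0, mul_pow, hc]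
      have : ∑ v ∈ (univ.erase s).erase t, y v ^ r = ∑ v ∈ (univ.erase s).erase t, x v ^ r := by
        refine Finset.sum_congr rfl fun v hv => ?_
        simp only [Finset.mem_erase] at hv
        rw [hyo v hv.2.1 hv.1]
      rw [this]; ring
  have hCy : cC G r y s t = c * cC G r x s t := by
    unfold cC
    rw [Finset.mul_sum]
    refine Finset.sum_congr rfl fun L hL => ?_
    simp only [Finset.mem_filter] at hL
    rw [← Finset.mul_prod_erase L y hL.2.2, ← Finset.mul_prod_erase L x hL.2.2, hys, mul_assoc]
    congr 2
    refine Finset.prod_congr rfl fun v hv => ?_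
    simp only [Finset.mem_erase] at hv
    exact hyo v hv.1 (fun h => hL.2.1 (h ▸ hv.2))
  have hDy : cD G r y s t = cD G r x s t := by
    unfold cD
    refine Finset.sum_congr rfl fun L hL => ?_
    simp only [Finset.mem_filter] at hL
    refine Finset.prod_congr rfl fun v hv => ?_
    exact hyo v (fun h => hL.2.2 (h ▸ hv)) (fun h => hL.2.1 (h ▸ hv))
  have hAH := cA_repl G r y s t hst
  rw [hys, hyt] at hAH
  have hAH' := mul_left_cancel₀ (mul_pos hc0 (hposK s hs)).ne' hAH
  have hle := hE.2 (G.replaceVertex s t) (hE.1.replaceVertex s t) y hy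
  rw [cF_eq _ r y t, cB_repl, cB_eq G r y s t, hAH', hCy, hDy, cF_eq G r x t, hA,
    cB_eq G r x s t] at hle
  nlinarith

lemma cF_repl {r : ℕ} {x : V → ℝ} {G : SimpleGraph V} (hpos : ∀ v, 0 < x v)
    {s t : V} (hst : s ≠ t) (h : ¬ G.Adj s t) :
    x s * (cF (G.replaceVertex s t) r x - cF G r x) = x t * cA G r x s - x s * cA G r x t := by
  have h1 := cA_repl G r x s t hst
  rw [cF_eq _ r x t, cB_repl, cF_eq G r x t, cA_eq_cC G r x s t hst h]
  linear_combination h1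

lemma ext_sym {r : ℕ} {x : V → ℝ} {G : SimpleGraph V} (hx : Feas r x)
    (hE : CExt r x G) (hpos : ∀ v, 0 < x v) {s t : V} (hst : s ≠ t) (h : ¬ G.Adj s t) :
    x t * cA G r x s = x s * cA G r x t ∧ CExt r x (G.replaceVertex s t) := by
  have h1 := cF_repl (r := r) hpos hst h
  have h2 := cF_repl (r := r) hpos hst.symm (fun h' => h h'.symm)
  have l1 := hE.2 (G.replaceVertex s t) (hE.1.replaceVertex s t) x hx
  have l2 := hE.2 (G.replaceVertex t s) (hE.1.replaceVertex t s) x hx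
  have e1 : x t * cA G r x s ≤ x s * cA G r x t := by
    have := mul_nonpos_of_nonneg_of_nonpos (hpos s).le (sub_nonpos.2 l1)
    linarith
  have e2 : x s * cA G r x t ≤ x t * cA G r x s := by
    have := mul_nonpos_of_nonneg_of_nonpos (hpos t).le (sub_nonpos.2 l2)
    linarith
  have e := le_antisymm e1 e2
  refine ⟨e, hE.1.replaceVertex s t, ?_⟩
  have h3 : cF (G.replaceVertex s t) r x - cF G r x = 0 := by
    have : x s * (cF (G.replaceVertex s t) r x - cF G r x) = 0 := by rw [h1, e, sub_self]
    exact (mul_eq_zero.1 this).resolve_left (hpos s).ne'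
  rw [sub_eq_zero.1 h3]
  exact hE.2

lemma ext_trans {r : ℕ} {x : V → ℝ} {G : SimpleGraph V} (hx : Feas r x)
    (hE : CExt r x G) (hpos : ∀ v, 0 < x v)
    (hcov : ∀ a b, G.Adj a b → ∃ K, G.IsNClique r K ∧ a ∈ K ∧ b ∈ K)
    {u v w : V} (huv : ¬ G.Adj u v) (hvw : ¬ G.Adj v w) : ¬ G.Adj u w := by
  intro huw
  have nuv : v ≠ u := fun h => hvw (h ▸ huw)
  have nvw : v ≠ w := fun h => huv (h ▸ huw)
  have nuw : u ≠ w := huw.ne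
  have huv' : ¬ G.Adj v u := fun h => huv h.symm
  obtain ⟨-, hH⟩ := ext_sym hx hE hpos nuv huv'
  obtain ⟨e1, -⟩ := ext_sym hx hE hpos nvw hvw
  have hvwH : ¬ (G.replaceVertex v u).Adj v w := by
    rwa [G.adj_replaceVertex_iff_of_ne_left v nuw.symm]
  have huwH : ¬ (G.replaceVertex v u).Adj w u := by
    rw [SimpleGraph.adj_comm, G.adj_replaceVertex_iff_of_ne_right v nuw.symm]
    exact hvw
  obtain ⟨e2, -⟩ := ext_sym hx hH hpos nvw hvwH
  rw [cA_eq_cC _ r x v u nuv (G.not_adj_replaceVertex_same v u), cC_repl,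
    ← cA_eq_cC G r x v u nuv huv', cA_eq_cC _ r x w u nuw.symm huwH, cC_repl, e1] at e2
  have e3 := mul_left_cancel₀ (hpos v).ne' e2
  obtain ⟨K, hK, huK, hwK⟩ := hcov u w huw
  refine absurd e3 (ne_of_gt ?_)
  unfold cA cC
  refine Finset.sum_lt_sum_of_subset (i := K) ?_ ?_ ?_ ?_ ?_
  · intro L hL
    simp only [Finset.mem_filter] at hL ⊢
    exact ⟨hL.1, hL.2.2⟩
  · simp [mem_rCl, hK, hwK]
  · simp [huK]
  · exact Finset.prod_pos fun i _ => hpos i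
  · intro L _ _
    exact Finset.prod_nonneg fun i _ => (hpos i).le

lemma exists_max [Nonempty V] {r : ℕ} (hr : r ≠ 0) (G : SimpleGraph V) :
    ∃ x, Feas r x ∧ ∀ y, Feas r y → cF G r y ≤ cF G r x := by
  have hcl : IsClosed {x : V → ℝ | Feas r x} := by
    have : {x : V → ℝ | Feas r x} = {x | ∀ v, 0 ≤ x v} ∩ {x | ∑ v, x v ^ r = 1} := rfl
    rw [this]
    refine IsClosed.inter ?_ (isClosed_eq (by fun_prop) (by fun_prop))
    simp only [Set.ofPred_forall]
    exact isClosed_iInter fun v => isClosed_le (by fun_prop) (by fun_prop)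
  have hcomp : IsCompact {x : V → ℝ | Feas r x} := by
    refine (isCompact_Icc (a := (0 : V → ℝ)) (b := 1)).of_isClosed_subset hcl ?_
    intro x hx
    refine ⟨hx.1, fun v => ?_⟩
    have h : x v ^ r ≤ 1 := by
      rw [← hx.2]
      exact Finset.single_le_sum (f := fun v => x v ^ r) (fun i _ => pow_nonneg (hx.1 i) r)
        (Finset.mem_univ v)
    exact (pow_le_one_iff_of_nonneg (hx.1 v) hr).1 h
  have hne : {x : V → ℝ | Feas r x}.Nonempty := by
    obtain ⟨v⟩ := ‹Nonempty V›
    refine ⟨Pi.single v 1, fun w => ?_, ?_⟩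
    · by_cases h : w = v
      · subst h; simp
      · simp [h]
    · rw [Finset.sum_eq_single v]
      · simp
      · intro b _ hb; simp [hb, hr]
      · simp
  have hcont : ContinuousOn (cF G r) {x : V → ℝ | Feas r x} := by
    unfold cF
    fun_prop
  obtain ⟨x, hx, hm⟩ := hcomp.exists_isMaxOn hne hcont
  exact ⟨x, hx, fun y hy => hm hy⟩

lemma rad_isGreatest {r : ℕ} (G : SimpleGraph V) (x : V → ℝ) (hx : Feas r x)
    (hm : ∀ y, Feas r y → cF G r y ≤ cF G r x) : cliqueSpecRad G r = r * cF G r x := by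
  unfold cliqueSpecRad
  refine IsGreatest.csSup_eq ⟨⟨x, hx.1, hx.2, rfl⟩, ?_⟩
  rintro _ ⟨y, h1, h2, rfl⟩
  exact mul_le_mul_of_nonneg_left (hm y ⟨h1, h2⟩) (Nat.cast_nonneg r)

lemma final_partite {r : ℕ} (G G₂ : SimpleGraph V) (hle : G₂ ≤ G) (hfree : G.CliqueFree (r + 1))
    (K : Finset V) (hK : G₂.IsNClique r K)
    (htr : ∀ u v w, ¬ G₂.Adj u v → ¬ G₂.Adj v w → ¬ G₂.Adj u w) :
    ∃ P : V → Fin r, (∀ j : Fin r, ∃ v, P v = j) ∧ (∀ u v, G.Adj u v ↔ P u ≠ P v) := by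
  have hfree₂ : G₂.CliqueFree (r + 1) := hfree.anti hle
  have hex : ∀ v, ∃ k : K, ¬ G₂.Adj v k := by
    intro v
    by_contra! hcon
    exact hfree₂ _ (hK.insert (a := v) fun b hb => hcon ⟨b, hb⟩)
  choose p hp using hex
  have hne : ∀ k k' : K, ¬ G₂.Adj k k' → k = k' := by
    intro k k' h
    by_contra hn
    exact h (hK.1 k.2 k'.2 fun h' => hn (Subtype.ext h'))
  have hsymm : ∀ {a b}, ¬ G₂.Adj a b → ¬ G₂.Adj b a := fun h h' => h h'.symm
  have huniq : ∀ (v : V) (k : K), ¬ G₂.Adj v k → p v = k := fun v k h =>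
    hne _ _ (htr _ _ _ (hsymm (hp v)) h)
  let e : K ≃ Fin r := K.equivFinOfCardEq hK.2
  refine ⟨fun v => e (p v), fun j => ⟨e.symm j, ?_⟩, fun u v => ?_⟩
  · have : p (e.symm j) = e.symm j := huniq _ _ (by simp)
    simp [this]
  · rw [ne_eq, e.apply_eq_iff_eq]
    constructor
    · intro hadj heq
      have h1 : G.IsNClique r (insert u (K.erase (p u))) := by
        refine (hK.mono hle).insert_erase ?_ (p u).2
        intro w hw
        simp only [Finset.mem_sdiff, Finset.mem_singleton] at hw
        by_contra hn
        exact hw.2 (by rw [huniq u ⟨w, hw.1⟩ fun h => hn (hle h)])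
      refine hfree _ (h1.insert (a := v) ?_)
      intro b hb
      rw [Finset.mem_insert, Finset.mem_erase] at hb
      rcases hb with rfl | hb
      · exact hadj.symm
      · by_contra hn
        exact hb.1 (by rw [heq, huniq v ⟨b, hb.2⟩ fun h => hn (hle h)])
    · intro h
      by_contra hn
      exact h (huniq u (p v) (htr _ _ _ (fun h => hn (hle h)) (hp v)))

end aux

theorem stmt_8 (r n : ℕ) (hr : 2 ≤ r) (hn : r ≤ n) (G' : SimpleGraph (Fin n))
    (hfree : G'.CliqueFree (r + 1))
    (hmax : ∀ H : SimpleGraph (Fin n), H.CliqueFree (r + 1) →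
      cliqueSpecRad H r ≤ cliqueSpecRad G' r) :
    ∃ P : Fin n → Fin r, (∀ j : Fin r, ∃ v, P v = j) ∧
      (∀ u v : Fin n, G'.Adj u v ↔ P u ≠ P v) := by
  have hr0 : r ≠ 0 := by omega
  have hrp : (0:ℝ) < r := by exact_mod_cast Nat.pos_of_ne_zero hr0
  haveI : Nonempty (Fin n) := ⟨⟨0, by omega⟩⟩
  obtain ⟨x, hx, hxm⟩ := exists_max hr0 G'
  have hE : CExt r x G' := by
    refine ⟨hfree, fun H hH y hy => ?_⟩
    obtain ⟨z, hz, hzm⟩ := exists_max hr0 H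
    have h := hmax H hH
    rw [rad_isGreatest H z hz hzm, rad_isGreatest G' x hx hxm] at h
    exact (hzm y hy).trans (le_of_mul_le_mul_left h hrp)
  have hf : 0 < cF G' r x := by
    have hn0 : (0:ℝ) < n := by exact_mod_cast (by omega : 0 < n)
    let c : ℝ := ((n:ℝ)⁻¹) ^ ((r:ℝ)⁻¹)
    have hc0 : 0 < c := by positivity
    have hc : c ^ r = (n:ℝ)⁻¹ := Real.rpow_inv_natCast_pow (by positivity) hr0
    have hy : Feas r (fun _ : Fin n => c) := by
      refine ⟨fun _ => hc0.le, ?_⟩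
      simp [hc, hn0.ne']
    refine lt_of_lt_of_le ?_
      (hE.2 _ (SimpleGraph.turanGraph_cliqueFree (n := n) (by omega : 0 < r)) _ hy)
    unfold cF
    refine Finset.sum_pos (fun K _ => Finset.prod_pos fun _ _ => hc0) ?_
    refine ⟨Finset.univ.map (Fin.castLEEmb hn), mem_rCl.2 ⟨?_, by simp⟩⟩
    intro a ha b hb hab
    simp only [Finset.coe_map, Set.mem_image, Finset.coe_univ, Set.mem_univ, true_and] at ha hb
    obtain ⟨i, rfl⟩ := ha
    obtain ⟨j, rfl⟩ := hb
    rw [SimpleGraph.turanGraph_adj]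
    simp only [Fin.castLEEmb_apply, Fin.val_castLE, Nat.mod_eq_of_lt i.2, Nat.mod_eq_of_lt j.2]
    intro h
    exact hab (by rw [Fin.ext h])
  have hpos := ext_pos hr hx hE hf
  let G₂ : SimpleGraph (Fin n) :=
    { Adj := fun a b => G'.Adj a b ∧ ∃ K, G'.IsNClique r K ∧ a ∈ K ∧ b ∈ K
      symm := ⟨fun a b ⟨h, K, h1, h2, h3⟩ => ⟨h.symm, K, h1, h3, h2⟩⟩
      loopless := ⟨fun a h => G'.loopless.irrefl a h.1⟩ }
  have hle : G₂ ≤ G' := fun a b h => h.1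
  have hcl : ∀ K, G₂.IsNClique r K ↔ G'.IsNClique r K := fun K =>
    ⟨fun h => h.mono hle, fun h => ⟨fun a ha b hb hab => ⟨h.1 ha hb hab, K, h, ha, hb⟩, h.2⟩⟩
  have hrc : rCliques G₂ r = rCliques G' r := by
    ext K; rw [mem_rCl, mem_rCl, hcl]
  have hE₂ : CExt r x G₂ := by
    refine ⟨hfree.anti hle, ?_⟩
    have : cF G₂ r x = cF G' r x := by unfold cF; rw [hrc]
    rw [this]; exact hE.2
  obtain ⟨K, hK⟩ : (rCliques G' r).Nonempty := by
    by_contra hcon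
    rw [Finset.not_nonempty_iff_eq_empty] at hcon
    simp [cF, hcon] at hf
  refine final_partite G' G₂ hle hfree K ((hcl K).2 (mem_rCl.1 hK)) ?_
  intro u v w h1 h2
  refine ext_trans hx hE₂ hpos ?_ h1 h2
  rintro a b ⟨_, K, h1, h2, h3⟩
  exact ⟨K, (hcl K).2 h1, h2, h3⟩
end
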